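/- arXiv:math/0610347 — 3 statements merged into one kernel-verified Lean document; each statement's English description precedes it below -/
import Mathlib

section
/- Let L be a finite-dimensional 2-soluble n-Lie algebra and let A be a minimal abelian embedded ideal of L with C_L(A) = A. Then L splits over A: there exists a subalgebra U of L with U + A = L and U ∩ A = 0. -/
namespace NLie

open Finset

variable {F : Type*} [Field F] {L : Type*} [AddCommGroup L] [Module F L] {n : ℕ}

/-- The generalized Jacobi identity for an `(n+2)`-ary alternating bracket:
`[y₁,…,y_{n+1},[x₁,…,x_{n+2}]] = ∑ᵢ [x₁,…,[y₁,…,y_{n+1},xᵢ],…,x_{n+2}]`.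
(This is the identity (1) of the paper, rewritten with the string `y` in the
first `n+1` slots, which is equivalent since the bracket is alternating.) -/
def IsNLie (f : AlternatingMap F L L (Fin (n + 2))) : Prop :=
  ∀ (y : Fin (n + 1) → L) (x : Fin (n + 2) → L),
    f (Fin.snoc y (f x)) = ∑ i, f (Function.update x i (f (Fin.snoc y (x i))))

/-- `d : L → L` is a derivation of the bracket `f`. -/
def IsDerivation (f : AlternatingMap F L L (Fin (n + 2))) (d : L →ₗ[F] L) : Prop :=
  ∀ x : Fin (n + 2) → L, d (f x) = ∑ i, f (Function.update x i (d (x i)))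

/-- The (inner) derivation `D(a₁,…,a_{n+1}) : x ↦ [a₁,…,a_{n+1},x]`. -/
def D (f : AlternatingMap F L L (Fin (n + 2))) (a : Fin (n + 1) → L) : L →ₗ[F] L where
  toFun x := f (Fin.snoc a x)
  map_add' x y := by
    have h := f.toMultilinearMap.map_update_add (Fin.snoc a x) (Fin.last (n + 1)) x y
    simpa [Fin.update_snoc_last] using h
  map_smul' c x := by
    have h := f.toMultilinearMap.map_update_smul (Fin.snoc a x) (Fin.last (n + 1)) c x
    simpa [Fin.update_snoc_last] using h

/-- `D(U)`: the span of all inner derivations `D(a₁,…,a_{n+1})` with all `aᵢ ∈ U`. -/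
def Dspan (f : AlternatingMap F L L (Fin (n + 2))) (U : Submodule F L) :
    Submodule F (L →ₗ[F] L) :=
  Submodule.span F {d | ∃ a : Fin (n + 1) → L, (∀ i, a i ∈ U) ∧ d = D f a}

/-- The Engel subspace `E_L(d) = {x ∈ L ∣ dʳ x = 0 for some r}`. -/
def engel (d : L →ₗ[F] L) : Submodule F L where
  carrier := {x | ∃ r, (d ^ r) x = 0}
  zero_mem' := ⟨0, map_zero _⟩
  add_mem' := by
    rintro a b ⟨r, hr⟩ ⟨s, hs⟩
    refine ⟨r + s, ?_⟩
    have h1 : (d ^ (r + s)) a = (d ^ s) ((d ^ r) a) := by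
      rw [add_comm r s, pow_add]; rfl
    have h2 : (d ^ (r + s)) b = (d ^ r) ((d ^ s) b) := by
      rw [pow_add]; rfl
    rw [map_add, h1, h2, hr, hs, map_zero, map_zero, add_zero]
  smul_mem' := by
    rintro c a ⟨r, hr⟩
    exact ⟨r, by rw [map_smul, hr, smul_zero]⟩

/-- `E` is an Engel subalgebra of `L`: `E = E_L(d)` for some inner derivation `d ∈ D(E)`. -/
def IsEngel (f : AlternatingMap F L L (Fin (n + 2))) (E : Submodule F L) : Prop :=
  ∃ d : L →ₗ[F] L, d ∈ Dspan f E ∧ E = engel d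

/-- `[A₁,…,A_{n+2}]`: the subspace spanned by all brackets with `aᵢ ∈ Aᵢ`. -/
def bracketSpan (f : AlternatingMap F L L (Fin (n + 2))) (A : Fin (n + 2) → Submodule F L) :
    Submodule F L :=
  Submodule.span F {z | ∃ a : Fin (n + 2) → L, (∀ i, a i ∈ A i) ∧ f a = z}

/-- `K` is a subalgebra of `L`. -/
def IsSubalg (f : AlternatingMap F L L (Fin (n + 2))) (K : Submodule F L) : Prop :=
  ∀ a : Fin (n + 2) → L, (∀ i, a i ∈ K) → f a ∈ K

/-- `K` is an ideal of `L` : `[K,L,…,L] ⊆ K`. -/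
def IsIdeal (f : AlternatingMap F L L (Fin (n + 2))) (K : Submodule F L) : Prop :=
  ∀ a : Fin (n + 2) → L, a 0 ∈ K → f a ∈ K

/-- `V` is an ideal of the subalgebra `W`. -/
def IsIdealIn (f : AlternatingMap F L L (Fin (n + 2))) (V W : Submodule F L) : Prop :=
  V ≤ W ∧ ∀ a : Fin (n + 2) → L, a 0 ∈ V → (∀ i, a i ∈ W) → f a ∈ V

/-- `M` is a maximal proper subalgebra of `L`. -/
def IsMaximalSubalg (f : AlternatingMap F L L (Fin (n + 2))) (M : Submodule F L) : Prop :=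
  IsSubalg f M ∧ M ≠ ⊤ ∧ ∀ U : Submodule F L, IsSubalg f U → M < U → U = ⊤

/-- The Frattini subalgebra: the intersection of all maximal proper subalgebras. -/
def frattini (f : AlternatingMap F L L (Fin (n + 2))) : Submodule F L :=
  sInf {M | IsMaximalSubalg f M}

/-- The lower central series of a subalgebra `U`:
`U¹ = U`, `U^{s+1} = [Uˢ, U,…,U]`. (`lcsIn f U s` is `U^{s+1}`.) -/
def lcsIn (f : AlternatingMap F L L (Fin (n + 2))) (U : Submodule F L) : ℕ → Submodule F L
  | 0 => U
  | s + 1 => bracketSpan f (Fin.cons (lcsIn f U s) fun _ => U)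

/-- `L` is a nilpotent `(n+2)`-Lie algebra. -/
def IsNilpotentAlg (f : AlternatingMap F L L (Fin (n + 2))) : Prop :=
  ∃ r, lcsIn f ⊤ r = ⊥

/-- The lower central series of `U` modulo `K`: `U/K` is nilpotent iff some term
of this series is contained in `K`. -/
def lcsMod (f : AlternatingMap F L L (Fin (n + 2))) (U K : Submodule F L) : ℕ → Submodule F L
  | 0 => U
  | s + 1 => bracketSpan f (Fin.cons (lcsMod f U K s) fun _ => U) ⊔ K

/-- The series `K¹ = K`, `K^{s+1} = [Kˢ, K, L,…,L]` used to define
"2-nilpotently embedded". -/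
def nes2 (f : AlternatingMap F L L (Fin (n + 2))) (K : Submodule F L) : ℕ → Submodule F L
  | 0 => K
  | s + 1 => bracketSpan f (Fin.cons (nes2 f K s) (Fin.cons K fun _ => ⊤))

/-- The series of `B` modulo `A`, so that `B/A` is 2-nilpotently embedded in `L/A`
iff some term of this series is contained in `A`. -/
def nes2Mod (f : AlternatingMap F L L (Fin (n + 2))) (B A : Submodule F L) : ℕ → Submodule F L
  | 0 => B
  | s + 1 => bracketSpan f (Fin.cons (nes2Mod f B A s) (Fin.cons B fun _ => ⊤)) ⊔ A

/-- The 2-derived series: `L⁽⁰⁾ = L`, `L⁽ˢ⁺¹⁾ = [L⁽ˢ⁾, L⁽ˢ⁾, L,…,L]`. -/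
def ds2 (f : AlternatingMap F L L (Fin (n + 2))) : ℕ → Submodule F L
  | 0 => ⊤
  | s + 1 => bracketSpan f (Fin.cons (ds2 f s) (Fin.cons (ds2 f s) fun _ => ⊤))

/-- `L` is 2-soluble. -/
def Is2Soluble (f : AlternatingMap F L L (Fin (n + 2))) : Prop :=
  ∃ r, ds2 f r = ⊥

/-- The `k`-derived series of an ideal `K`:
`K⁽⁰⁾ = K`, `K⁽ˢ⁺¹⁾ = [(k)K⁽ˢ⁾, (n+2-k)L]`: `K` is `k`-solubly embedded in `L`
iff some term vanishes. -/
def dsk (f : AlternatingMap F L L (Fin (n + 2))) (k : ℕ) (K : Submodule F L) :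
    ℕ → Submodule F L
  | 0 => K
  | s + 1 => bracketSpan f (fun i => if (i : ℕ) < k then dsk f k K s else ⊤)

/-- The `k`-derived series of `A` modulo `B`: `A/B` is `k`-solubly embedded in `L/B`
iff some term of this series is contained in `B`. -/
def dskMod (f : AlternatingMap F L L (Fin (n + 2))) (k : ℕ) (A B : Submodule F L) :
    ℕ → Submodule F L
  | 0 => A
  | s + 1 => bracketSpan f (fun i => if (i : ℕ) < k then dskMod f k A B s else ⊤) ⊔ B

/-- The ideal `A` is abelian embedded in `L`: `[A,A,L,…,L] = 0`. -/
def IsAbelianEmbedded (f : AlternatingMap F L L (Fin (n + 2))) (A : Submodule F L) : Prop :=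
  ∀ a : Fin (n + 2) → L, a 0 ∈ A → a 1 ∈ A → f a = 0

/-- `A` is a minimal abelian embedded ideal of `L`: a nonzero abelian embedded ideal
whose only properly contained ideal is `0`. -/
def IsMinAbelianEmbeddedIdeal (f : AlternatingMap F L L (Fin (n + 2)))
    (A : Submodule F L) : Prop :=
  A ≠ ⊥ ∧ IsIdeal f A ∧ IsAbelianEmbedded f A ∧
    ∀ B : Submodule F L, IsIdeal f B → B < A → B = ⊥

/-- The normalizer `N_L(U) = {x ∈ L ∣ [x,u₁,…,u_{n+1}] ∈ U for all uᵢ ∈ U}`. -/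
def normalizer (f : AlternatingMap F L L (Fin (n + 2))) (U : Submodule F L) : Set L :=
  {x | ∀ u : Fin (n + 1) → L, (∀ i, u i ∈ U) → f (Fin.cons x u) ∈ U}

/-- The centralizer `C_L(A) = {c ∈ L ∣ [c,a,x₃,…,x_{n+2}] = 0 for all a ∈ A, xᵢ ∈ L}`. -/
def centralizer (f : AlternatingMap F L L (Fin (n + 2))) (A : Submodule F L) : Set L :=
  {c | ∀ a ∈ A, ∀ x : Fin n → L, f (Fin.cons c (Fin.cons a x)) = 0}

/-- `S` is a Cartan subalgebra of `L`: a nilpotent self-normalizing subalgebra. -/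
def IsCartan (f : AlternatingMap F L L (Fin (n + 2))) (S : Submodule F L) : Prop :=
  IsSubalg f S ∧ (∃ r, lcsIn f S r = ⊥) ∧ normalizer f S = (S : Set L)

/-- `U` is a subnormal subalgebra of `L`. -/
def IsSubnormal (f : AlternatingMap F L L (Fin (n + 2))) (U : Submodule F L) : Prop :=
  ∃ (r : ℕ) (C : ℕ → Submodule F L), C 0 = U ∧ C r = ⊤ ∧
    (∀ i ≤ r, IsSubalg f (C i)) ∧ ∀ i < r, IsIdealIn f (C i) (C (i + 1))

/-- An `A`-inner automorphism: a finite product of maps `1 + D(a,x₂,…,x_{n+1})`,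
`a ∈ A`, where `A` is an abelian embedded ideal. -/
def IsAInner (f : AlternatingMap F L L (Fin (n + 2))) (A : Submodule F L)
    (α : L →ₗ[F] L) : Prop :=
  ∃ (m : ℕ) (g : Fin m → (L →ₗ[F] L)),
    (∀ j, ∃ (a : L) (x : Fin n → L), a ∈ A ∧ g j = LinearMap.id + D f (Fin.cons a x)) ∧
    α = (List.ofFn g).prod


/-! ### Basic properties of the inner derivations -/

theorem D_apply (f : AlternatingMap F L L (Fin (n + 2))) (a : Fin (n + 1) → L) (x : L) :
    D f a x = f (Fin.snoc a x) := rfl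

theorem isDerivation_D {f : AlternatingMap F L L (Fin (n + 2))} (hf : IsNLie f)
    (y : Fin (n + 1) → L) : IsDerivation f (D f y) := fun x => hf y x

/-- The commutator of two inner derivations. -/
theorem D_D_apply {f : AlternatingMap F L L (Fin (n + 2))} (hf : IsNLie f)
    (y c : Fin (n + 1) → L) (a : L) :
    D f y (D f c a) =
      ∑ i, D f (Function.update c i (D f y (c i))) a + D f c (D f y a) := by
  rw [D_apply f c a, isDerivation_D hf y, Fin.sum_univ_castSucc]
  simp [D_apply, Fin.snoc_update, Fin.update_snoc_last]

theorem map_perm_mem_iff (f : AlternatingMap F L L (Fin (n + 2))) (K : Submodule F L)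
    (σ : Equiv.Perm (Fin (n + 2))) (a : Fin (n + 2) → L) :
    f (a ∘ σ) ∈ K ↔ f a ∈ K := by
  rw [f.map_perm]
  rcases Int.units_eq_one_or (Equiv.Perm.sign σ) with h | h <;> simp [h]

theorem IsIdeal.map_mem {f : AlternatingMap F L L (Fin (n + 2))} {K : Submodule F L}
    (hK : IsIdeal f K) {a : Fin (n + 2) → L} {i : Fin (n + 2)} (hi : a i ∈ K) : f a ∈ K := by
  rw [← map_perm_mem_iff f K (Equiv.swap 0 i)]
  exact hK _ (by simpa using hi)

theorem IsIdeal.D_mem {f : AlternatingMap F L L (Fin (n + 2))} {K : Submodule F L}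
    (hK : IsIdeal f K) (y : Fin (n + 1) → L) {x : L} (hx : x ∈ K) : D f y x ∈ K :=
  hK.map_mem (i := Fin.last (n + 1)) (by simpa using hx)

theorem IsIdeal.D_mem_of_mem {f : AlternatingMap F L L (Fin (n + 2))} {K : Submodule F L}
    (hK : IsIdeal f K) {y : Fin (n + 1) → L} {i : Fin (n + 1)} (hi : y i ∈ K) (x : L) :
    D f y x ∈ K :=
  hK.map_mem (i := i.castSucc) (by simpa using hi)

theorem isIdeal_of_D_mem {f : AlternatingMap F L L (Fin (n + 2))} {K : Submodule F L}
    (hK : ∀ (y : Fin (n + 1) → L), ∀ x ∈ K, D f y x ∈ K) : IsIdeal f K := by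
  intro a ha
  rw [← map_perm_mem_iff f K (Equiv.swap 0 (Fin.last (n + 1)))]
  have h := hK (Fin.init (a ∘ Equiv.swap 0 (Fin.last (n + 1)))) (a 0) ha
  rw [D_apply] at h
  convert h using 2
  conv_lhs => rw [← Fin.snoc_init_self (a ∘ Equiv.swap 0 (Fin.last (n + 1)))]
  simp

/-- A bracket condition on the first two slots holds for any two distinct slots. -/
theorem map_mem_of_two {f : AlternatingMap F L L (Fin (n + 2))} {B K : Submodule F L}
    (h : ∀ a : Fin (n + 2) → L, a 0 ∈ B → a 1 ∈ B → f a ∈ K)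
    {a : Fin (n + 2) → L} {i j : Fin (n + 2)} (hij : i ≠ j) (hi : a i ∈ B) (hj : a j ∈ B) :
    f a ∈ K := by
  have hj0 : Equiv.swap 0 i j ≠ 0 := by
    intro h0
    apply hij
    exact (Equiv.swap 0 i).injective ((Equiv.swap_apply_right 0 i).trans h0.symm)
  rw [← map_perm_mem_iff f K (Equiv.swap 0 i * Equiv.swap 1 (Equiv.swap 0 i j))]
  refine h _ ?_ ?_
  · simpa [Equiv.swap_apply_of_ne_of_ne (zero_ne_one : (0 : Fin (n + 2)) ≠ 1) hj0.symm] using hi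
  · simpa using hj

/-- The Engel subspace of a derivation is a subalgebra. -/
theorem IsDerivation.isSubalg_engel {f : AlternatingMap F L L (Fin (n + 2))}
    {k : L →ₗ[F] L} (hk : IsDerivation f k) : IsSubalg f (engel k) := by
  have key : ∀ (N : ℕ) (r : Fin (n + 2) → ℕ) (a : Fin (n + 2) → L), ∑ i, r i ≤ N →
      (∀ i, (k ^ r i) (a i) = 0) → (k ^ (N + 1)) (f a) = 0 := by
    intro N
    induction N with
    | zero =>
      intro r a hr ha
      have hr0 : r 0 = 0 := by
        have := Finset.single_le_sum (fun i _ => Nat.zero_le (r i)) (Finset.mem_univ 0)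
        omega
      have h0 := ha 0
      rw [hr0, pow_zero, Module.End.one_apply] at h0
      rw [f.map_coord_zero 0 h0, map_zero]
    | succ N ih =>
      intro r a hr ha
      rw [pow_succ, Module.End.mul_apply, hk, map_sum]
      refine Finset.sum_eq_zero fun i _ => ?_
      rcases Nat.eq_zero_or_pos (r i) with h0 | h0
      · have hi := ha i
        rw [h0, pow_zero, Module.End.one_apply] at hi
        rw [f.map_coord_zero i (by simp [hi]), map_zero]
      · refine ih (Function.update r i (r i - 1)) _ ?_ fun j => ?_
        · have h1 := Finset.sum_update_of_mem (Finset.mem_univ i) r (r i - 1)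
          have h2 := Finset.sum_update_of_mem (Finset.mem_univ i) r (r i)
          rw [Function.update_eq_self] at h2
          omega
        · rcases eq_or_ne j i with rfl | hj
          · simp only [Function.update_self]
            rw [← Module.End.mul_apply, ← pow_succ, Nat.sub_add_cancel h0, ha]
          · simp [hj, ha]
  intro a ha
  choose r hr using ha
  exact ⟨_, key _ r a le_rfl hr⟩

/-- If the commutator of `k` and `d` commutes with `k` on an invariant subspace, then `d`
preserves the Fitting null component of `k` there. -/
theorem map_mem_engel_of_commutator {k d : L →ₗ[F] L} {A : Submodule F L}
    (hk : ∀ a ∈ A, k a ∈ A)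
    (h : ∀ a ∈ A, k (k (d a) - d (k a)) = k (d (k a)) - d (k (k a)))
    {a : L} (ha : a ∈ A) (hE : a ∈ engel k) : d a ∈ engel k := by
  have hcomm : ∀ (m : ℕ), ∀ a ∈ A,
      (k ^ m) (k (d a) - d (k a)) = k (d ((k ^ m) a)) - d (k ((k ^ m) a)) := by
    intro m
    induction m with
    | zero => intro a _; simp
    | succ m ih =>
      intro a ha
      rw [pow_succ, Module.End.mul_apply, h a ha, ih _ (hk a ha), Module.End.mul_apply]
  have key : ∀ (m : ℕ), ∀ a ∈ A, (k ^ m) a = 0 → (k ^ (m + 1)) (d a) = 0 := by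
    intro m
    induction m with
    | zero =>
      intro a _ h0
      rw [pow_zero, Module.End.one_apply] at h0
      simp [h0]
    | succ m ih =>
      intro a ha h0
      have e : k (d a) = d (k a) + (k (d a) - d (k a)) := by abel
      rw [pow_succ, Module.End.mul_apply, e, map_add, hcomm _ a ha, h0,
        ih (k a) (hk a ha) (by rwa [pow_succ, Module.End.mul_apply] at h0)]
      simp
  obtain ⟨m, hm⟩ := hE
  exact ⟨m + 1, key m a ha hm⟩

theorem IsMinAbelianEmbeddedIdeal.eq_of_le {f : AlternatingMap F L L (Fin (n + 2))}
    {A B : Submodule F L} (hA : IsMinAbelianEmbeddedIdeal f A) (hB : IsIdeal f B) (hBA : B ≤ A)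
    (h0 : B ≠ ⊥) : B = A := by
  by_contra h
  exact h0 (hA.2.2.2 B hB (lt_of_le_of_ne hBA h))

/-- A nonzero family of inner derivations, stable under commutation with inner derivations and
commuting on a minimal ideal `A`, has a member that is injective on `A`. -/
theorem exists_D_injective [FiniteDimensional F L] {f : AlternatingMap F L L (Fin (n + 2))}
    (hf : IsNLie f) {A : Submodule F L} (hA : IsMinAbelianEmbeddedIdeal f A)
    (S : Set (Fin (n + 1) → L))
    (hS : ∀ c ∈ S, ∀ y i, Function.update c i (D f y (c i)) ∈ S)
    (hcomm : ∀ c ∈ S, ∀ c' ∈ S, ∀ a ∈ A, D f c (D f c' a) = D f c' (D f c a))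
    (hne : ∃ c ∈ S, ∃ a ∈ A, D f c a ≠ 0) :
    ∃ c ∈ S, ∀ a ∈ A, D f c a = 0 → a = 0 := by
  have hAi : IsIdeal f A := hA.2.1
  by_contra! hcon
  have hnil : ∀ c ∈ S, A ≤ engel (D f c) := by
    intro c hc
    have hid : IsIdeal f (engel (D f c) ⊓ A) := by
      refine isIdeal_of_D_mem fun y x hx => ⟨?_, hAi.D_mem y hx.2⟩
      refine map_mem_engel_of_commutator (A := A) (fun a ha => hAi.D_mem c ha)
        (fun a ha => ?_) hx.2 hx.1
      have e : ∀ a, D f c (D f y a) - D f y (D f c a)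
          = - ∑ i, D f (Function.update c i (D f y (c i))) a := by
        intro a
        rw [D_D_apply hf y c a]
        abel
      rw [e, e, map_neg, map_sum]
      congr 1
      exact Finset.sum_congr rfl fun i _ => hcomm c hc _ (hS c hc y i) a ha
    have h0 : engel (D f c) ⊓ A ≠ ⊥ := by
      obtain ⟨a, ha, ha0, hane⟩ := hcon c hc
      refine (Submodule.ne_bot_iff _).2 ⟨a, ⟨⟨1, ?_⟩, ha⟩, hane⟩
      simpa using ha0
    exact inf_eq_right.1 (hA.eq_of_le hid inf_le_right h0)
  obtain ⟨W, ⟨hW0, hWA, hWS⟩, hWmin⟩ := WellFounded.has_min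
    (wellFounded_lt : WellFounded ((· < ·) : Submodule F L → Submodule F L → Prop))
    {W | W ≠ ⊥ ∧ W ≤ A ∧ ∀ c ∈ S, ∀ w ∈ W, D f c w ∈ W}
    ⟨A, hA.1, le_rfl, fun c _ w hw => hAi.D_mem c hw⟩
  have hWker : ∀ c ∈ S, ∀ w ∈ W, D f c w = 0 := by
    intro c hc
    have hmem : W ⊓ LinearMap.ker (D f c) ∈
        {W | W ≠ ⊥ ∧ W ≤ A ∧ ∀ c ∈ S, ∀ w ∈ W, D f c w ∈ W} := by
      refine ⟨?_, inf_le_left.trans hWA, fun c' hc' w hw => ⟨hWS c' hc' w hw.1, ?_⟩⟩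
      · obtain ⟨w, hw, hw0⟩ := (Submodule.ne_bot_iff _).1 hW0
        have hpow : ∀ m : ℕ, ∀ w ∈ W, w ≠ 0 → (D f c ^ m) w = 0 →
            ∃ v ∈ W, D f c v = 0 ∧ v ≠ 0 := by
          intro m
          induction m with
          | zero => intro w _ h1 h2; exact absurd (by simpa using h2) h1
          | succ m ih =>
            intro w hw h1 h2
            by_cases h3 : D f c w = 0
            · exact ⟨w, hw, h3, h1⟩
            · exact ih _ (hWS c hc w hw) h3 (by rwa [pow_succ, Module.End.mul_apply] at h2)
        obtain ⟨m, hm⟩ := hnil c hc (hWA hw)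
        obtain ⟨v, hv, hv0, hvne⟩ := hpow m w hw hw0 hm
        exact (Submodule.ne_bot_iff _).2 ⟨v, ⟨hv, hv0⟩, hvne⟩
      · have hw2 : D f c w = 0 := hw.2
        exact LinearMap.mem_ker.2 (by rw [hcomm c hc c' hc' w (hWA hw.1), hw2, map_zero])
    have hle : W ≤ W ⊓ LinearMap.ker (D f c) := by
      by_contra hlt
      exact hWmin _ hmem (lt_of_le_not_ge inf_le_left hlt)
    exact fun w hw => (hle hw).2
  let J : Submodule F L := A ⊓ ⨅ c ∈ S, LinearMap.ker (D f c)
  have hJ : ∀ x, x ∈ J ↔ x ∈ A ∧ ∀ c ∈ S, D f c x = 0 := by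
    intro x
    simp [J]
  have hJid : IsIdeal f J := by
    refine isIdeal_of_D_mem fun y x hx => ?_
    rw [hJ] at hx ⊢
    refine ⟨hAi.D_mem y hx.1, fun c hc => ?_⟩
    have e := D_D_apply hf y c x
    rw [hx.2 c hc, map_zero,
      Finset.sum_eq_zero fun i _ => hx.2 _ (hS c hc y i), zero_add] at e
    exact e.symm
  have hJ0 : J ≠ ⊥ := by
    obtain ⟨w, hw, hw0⟩ := (Submodule.ne_bot_iff _).1 hW0
    exact (Submodule.ne_bot_iff _).2
      ⟨w, (hJ w).2 ⟨hWA hw, fun c hc => hWker c hc w hw⟩, hw0⟩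
  have hJA := hA.eq_of_le hJid inf_le_left hJ0
  obtain ⟨c, hc, a, ha, hca⟩ := hne
  rw [← hJA] at ha
  exact hca (((hJ a).1 ha).2 c hc)

theorem map_mem_ds2_succ (f : AlternatingMap F L L (Fin (n + 2))) (s : ℕ)
    (a : Fin (n + 2) → L) (h0 : a 0 ∈ ds2 f s) (h1 : a 1 ∈ ds2 f s) :
    f a ∈ ds2 f (s + 1) := by
  refine Submodule.subset_span ⟨a, fun i => ?_, rfl⟩
  refine Fin.cases ?_ (fun i => ?_) i
  · simpa using h0
  · refine Fin.cases ?_ (fun i => ?_) i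
    · simpa using h1
    · simp

theorem isIdeal_ds2 {f : AlternatingMap F L L (Fin (n + 2))} (hf : IsNLie f) (s : ℕ) :
    IsIdeal f (ds2 f s) := by
  induction s with
  | zero => exact fun _ _ => Submodule.mem_top
  | succ s ih =>
    refine isIdeal_of_D_mem fun y x hx => ?_
    refine Submodule.span_induction (p := fun x _ => D f y x ∈ ds2 f (s + 1)) ?_ ?_ ?_ ?_ hx
    · rintro _ ⟨a, ha, rfl⟩
      have h0 : a 0 ∈ ds2 f s := by simpa using ha 0
      have h1 : a 1 ∈ ds2 f s := by simpa using ha 1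
      rw [isDerivation_D hf y]
      refine Submodule.sum_mem _ fun i _ => map_mem_ds2_succ f s _ ?_ ?_
      · by_cases h : (0 : Fin (n + 2)) = i
        · subst h
          simpa using ih.D_mem y h0
        · simpa [Function.update_of_ne h] using h0
      · by_cases h : (1 : Fin (n + 2)) = i
        · subst h
          simpa using ih.D_mem y h1
        · simpa [Function.update_of_ne h] using h1
    · rw [map_zero]; exact zero_mem _
    · intro x z _ _ hx hz
      rw [map_add]; exact add_mem hx hz
    · intro r x _ hx
      rw [map_smul]; exact Submodule.smul_mem _ _ hx

theorem Is2Soluble.exists_ideal {f : AlternatingMap F L L (Fin (n + 2))} (hf : IsNLie f)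
    (hsol : Is2Soluble f) {A : Submodule F L} (hA : A ≠ ⊤) :
    ∃ B : Submodule F L, IsIdeal f B ∧ ¬ B ≤ A ∧
      ∀ a : Fin (n + 2) → L, a 0 ∈ B → a 1 ∈ B → f a ∈ A := by
  classical
  have hex : ∃ r, ds2 f r ≤ A := by
    obtain ⟨r, hr⟩ := hsol
    exact ⟨r, hr ▸ bot_le⟩
  have hspec := Nat.find_spec hex
  obtain ⟨s, hs⟩ : ∃ s, Nat.find hex = s + 1 := by
    refine Nat.exists_eq_succ_of_ne_zero fun h0 => hA ?_
    rw [h0] at hspec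
    exact top_le_iff.1 hspec
  rw [hs] at hspec
  exact ⟨ds2 f s, isIdeal_ds2 hf s, Nat.find_min hex (by omega),
    fun a h0 h1 => hspec (map_mem_ds2_succ f s a h0 h1)⟩

/-- An ideal `B` with `[B,B,L,…,L] ⊆ A`, not contained in the self-centralizing minimal ideal `A`,
contains an entry of an inner derivation that is injective on `A`. -/
theorem exists_D_injective_of_ideal [FiniteDimensional F L]
    {f : AlternatingMap F L L (Fin (n + 2))} (hf : IsNLie f) {A B : Submodule F L}
    (hA : IsMinAbelianEmbeddedIdeal f A) (hC : centralizer f A = (A : Set L))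
    (hB : IsIdeal f B) (hBA : ¬ B ≤ A)
    (hBB : ∀ a : Fin (n + 2) → L, a 0 ∈ B → a 1 ∈ B → f a ∈ A) :
    ∃ c : Fin (n + 1) → L, (∃ i, c i ∈ B) ∧ ∀ a ∈ A, D f c a = 0 → a = 0 := by
  have hDA : ∀ (c : Fin (n + 1) → L) (i), c i ∈ A → ∀ a ∈ A, D f c a = 0 := by
    intro c i hi a ha
    have h2 : ∀ a : Fin (n + 2) → L, a 0 ∈ A → a 1 ∈ A → f a ∈ (⊥ : Submodule F L) :=
      fun a h0 h1 => (Submodule.mem_bot F).2 (hA.2.2.1 a h0 h1)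
    exact (Submodule.mem_bot F).1 (map_mem_of_two h2 (i := i.castSucc) (j := Fin.last (n + 1))
      (Fin.castSucc_lt_last i).ne (by simpa using hi) (by simpa using ha))
  have hcomm : ∀ c c' : Fin (n + 1) → L, ∀ a,
      (∀ i, D f (Function.update c' i (D f c (c' i))) a = 0) →
      D f c (D f c' a) = D f c' (D f c a) := by
    intro c c' a h
    rw [D_D_apply hf c c' a, Finset.sum_eq_zero fun i _ => h i, zero_add]
  have hupd : ∀ (c : Fin (n + 1) → L) (y i j), c j ∈ B →
      Function.update c i (D f y (c i)) j ∈ B := by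
    intro c y i j hj
    by_cases h : j = i
    · subst h
      simpa using hB.D_mem y hj
    · simpa [Function.update_of_ne h] using hj
  by_cases htriv : ∀ c : Fin (n + 1) → L, (∃ i j, i ≠ j ∧ c i ∈ B ∧ c j ∈ B) →
      ∀ a ∈ A, D f c a = 0
  · refine exists_D_injective hf hA {c | ∃ i, c i ∈ B} ?_ ?_ ?_
    · rintro c ⟨j, hj⟩ y i
      exact ⟨j, hupd c y i j hj⟩
    · rintro c ⟨p, hp⟩ c' ⟨q, hq⟩ a ha
      refine hcomm c c' a fun i => ?_
      by_cases h : i = q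
      · subst h
        refine hDA _ i ?_ a ha
        rw [Function.update_self]
        exact map_mem_of_two hBB (i := p.castSucc) (j := Fin.last (n + 1))
          (Fin.castSucc_lt_last p).ne (by simpa using hp) (by simpa using hq)
      · refine htriv _ ⟨i, q, h, ?_, hupd c' c i q hq⟩ a ha
        rw [Function.update_self]
        exact hB.D_mem_of_mem hp _
    · obtain ⟨b, hb, hbA⟩ := SetLike.not_le_iff_exists.1 hBA
      have hbC : b ∉ centralizer f A := by rwa [hC]
      obtain ⟨a, ha, x, hx⟩ : ∃ a ∈ A, ∃ x : Fin n → L, f (Fin.cons b (Fin.cons a x)) ≠ 0 := by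
        by_contra! h
        exact hbC h
      set v : Fin (n + 2) → L := Fin.cons b (Fin.cons a x) with hv
      set σ : Equiv.Perm (Fin (n + 2)) := Equiv.swap 1 (Fin.last (n + 1)) with hσ
      have hσ0 : σ 0 = 0 :=
        Equiv.swap_apply_of_ne_of_ne zero_ne_one (Fin.last_pos.ne)
      refine ⟨Fin.init (v ∘ σ), ⟨0, ?_⟩, a, ha, ?_⟩
      · simpa [Fin.init, hσ0, hv] using hb
      · have hva : a = (v ∘ σ) (Fin.last (n + 1)) := by
          have h1 : v 1 = a := by rw [hv, ← Fin.succ_zero_eq_one]; simp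
          simp [hσ, h1]
        rw [D_apply, show Fin.snoc (Fin.init (v ∘ σ)) a = v ∘ σ from
          (congrArg (Fin.snoc _) hva).trans (Fin.snoc_init_self _)]
        intro h0
        exact hx ((Submodule.mem_bot F).1
          ((map_perm_mem_iff f ⊥ σ v).1 ((Submodule.mem_bot F).2 h0)))
  · push Not at htriv
    suffices h : ∃ c ∈ {c : Fin (n + 1) → L | ∃ i j, i ≠ j ∧ c i ∈ B ∧ c j ∈ B},
        ∀ a ∈ A, D f c a = 0 → a = 0 by
      obtain ⟨c, ⟨i, _, _, hi, _⟩, hinj⟩ := h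
      exact ⟨c, ⟨i, hi⟩, hinj⟩
    refine exists_D_injective hf hA _ ?_ ?_ htriv
    · rintro c ⟨p, q, hpq, hp, hq⟩ y i
      exact ⟨p, q, hpq, hupd c y i p hp, hupd c y i q hq⟩
    · rintro c ⟨p, q, hpq, hp, hq⟩ c' - a ha
      refine hcomm c c' a fun i => hDA _ i ?_ a ha
      rw [Function.update_self]
      exact map_mem_of_two hBB (i := p.castSucc) (j := q.castSucc)
        (by simpa using hpq) (by simpa using hp) (by simpa using hq)

/-- A finite-dimensional 2-soluble `n`-Lie algebra `L` with a minimal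
abelian embedded ideal `A` satisfying `C_L(A) = A` splits over `A`. -/
theorem stmt11 {F : Type*} [Field F] {L : Type*} [AddCommGroup L] [Module F L]
    [FiniteDimensional F L] {n : ℕ} (f : AlternatingMap F L L (Fin (n + 2)))
    (hf : IsNLie f) (hsol : Is2Soluble f)
    (A : Submodule F L) (hA : IsMinAbelianEmbeddedIdeal f A)
    (hC : centralizer f A = (A : Set L)) :
    ∃ U : Submodule F L, IsSubalg f U ∧ U ⊔ A = ⊤ ∧ U ⊓ A = ⊥ := by
  rcases eq_or_ne A ⊤ with rfl | hAtop
  · exact ⟨⊥, fun a ha => by rw [f.map_coord_zero 0 ((Submodule.mem_bot F).1 (ha 0))]; simp,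
      by simp, by simp⟩
  obtain ⟨B, hB, hBA, hBB⟩ := hsol.exists_ideal hf hAtop
  obtain ⟨c, ⟨i, hi⟩, hinj⟩ := exists_D_injective_of_ideal hf hA hC hB hBA hBB
  have hAc : ∀ a ∈ A, D f c a ∈ A := fun a ha => hA.2.1.D_mem c ha
  refine ⟨engel (D f c), (isDerivation_D hf c).isSubalg_engel, ?_, ?_⟩
  · have hsurj : Function.Surjective ((D f c).restrict hAc) := by
      refine LinearMap.surjective_of_injective ((injective_iff_map_eq_zero _).2 fun a ha => ?_)
      exact Subtype.ext (hinj a a.2 (congrArg Subtype.val ha))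
    refine eq_top_iff.2 fun x _ => ?_
    have hx : D f c (D f c x) ∈ A :=
      map_mem_of_two hBB (i := i.castSucc) (j := Fin.last (n + 1)) (Fin.castSucc_lt_last i).ne
        (by simpa using hi) (by simpa using hB.D_mem_of_mem hi x)
    obtain ⟨a, ha⟩ := hsurj ⟨_, hx⟩
    obtain ⟨a', rfl⟩ := hsurj a
    have ha' : D f c (D f c a') = D f c (D f c x) := congrArg Subtype.val ha
    refine Submodule.mem_sup.2 ⟨x - a', ⟨2, ?_⟩, a', a'.2, sub_add_cancel _ _⟩
    rw [pow_two, Module.End.mul_apply, map_sub, map_sub, ha', sub_self]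
  · refine (Submodule.eq_bot_iff _).2 ?_
    rintro x ⟨⟨m, hm⟩, hx⟩
    induction m generalizing x with
    | zero => simpa using hm
    | succ m ih =>
      rw [pow_succ, Module.End.mul_apply] at hm
      exact hinj x hx (ih _ (hAc x hx) hm)

end NLie
end

section
/- Let L be an n-Lie algebra of dimension k over a field F with at least k+1 elements. Then L has a Cartan subalgebra. -/
namespace NLie

open Finset

variable {F : Type*} [Field F] {L : Type*} [AddCommGroup L] [Module F L] {n : ℕ}

/-- The inner operator `x ↦ [a₁,…,aₘ,x]` of an alternating bracket of arity `m + 1`. -/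
def ad {m : ℕ} (f : AlternatingMap F L L (Fin (m + 1))) (a : Fin m → L) : L →ₗ[F] L :=
  f.toMultilinearMap.curryRight a

/-- The generalized Jacobi identity in arbitrary positive arity. -/
def IsJacobi {m : ℕ} (f : AlternatingMap F L L (Fin (m + 1))) : Prop :=
  ∀ (y : Fin m → L) (x : Fin (m + 1) → L),
    ad f y (f x) = ∑ i, f (Function.update x i (ad f y (x i)))

/-- A set of operators is triangular on `V` if every proper inclusion `W < V'` of invariant
subspaces of `V` admits a vector of `V' \ W` sent into `W` by all the operators. -/
def IsTriangularOn (S : Set (L →ₗ[F] L)) (V : Submodule F L) : Prop :=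
  ∀ W V' : Submodule F L, W < V' → V' ≤ V → (∀ s ∈ S, ∀ v ∈ W, s v ∈ W) →
    (∀ s ∈ S, ∀ v ∈ V', s v ∈ V') → ∃ v ∈ V', v ∉ W ∧ ∀ s ∈ S, s v ∈ W

/-- The inner operators with arguments in `U`. -/
def adSet {m : ℕ} (f : AlternatingMap F L L (Fin (m + 1))) (U : Submodule F L) :
    Set (L →ₗ[F] L) :=
  {d | ∃ a : Fin m → L, (∀ i, a i ∈ U) ∧ d = ad f a}

section Engel

variable {m : ℕ}

theorem ad_apply (f : AlternatingMap F L L (Fin (m + 1))) (a : Fin m → L) (x : L) :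
    ad f a x = f (Fin.snoc a x) := rfl

theorem ad_curryLeft (f : AlternatingMap F L L (Fin (m + 2))) (x : L) (a : Fin m → L) :
    ad (f.curryLeft x) a = ad f (Fin.cons x a) := by
  ext v
  rw [ad_apply, ad_apply, ← Fin.cons_snoc_eq_snoc_cons]
  rfl

theorem ad_mem_iff_cons_mem (f : AlternatingMap F L L (Fin (m + 1))) (W : Submodule F L)
    (a : Fin m → L) (x : L) : ad f a x ∈ W ↔ f (Fin.cons x a) ∈ W := by
  have h : (Fin.snoc a x : Fin (m + 1) → L) = (Fin.cons x a : Fin (m + 1) → L) ∘ finRotate _ :=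
    Fin.snoc_eq_cons_rotate _ _
  rw [ad_apply, h, f.map_perm]
  rcases Int.units_eq_one_or (Equiv.Perm.sign (finRotate (m + 1))) with h | h <;> simp [h]

theorem map_comp_swap_mem_iff {M : Type*} [AddCommGroup M] [Module F M]
    (f : AlternatingMap F L M (Fin m)) (W : Submodule F M) (u : Fin m → L) (i j : Fin m) :
    f (u ∘ Equiv.swap i j) ∈ W ↔ f u ∈ W := by
  rw [f.map_perm]
  rcases Int.units_eq_one_or (Equiv.Perm.sign (Equiv.swap i j)) with h | h <;> simp [h]

theorem map_mem_of_mem_sup_span_singleton {M : Type*} [AddCommGroup M] [Module F M]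
    (K : Submodule F L) (W : Submodule F M) (x : L) (f : AlternatingMap F L M (Fin m))
    (h₁ : ∀ u : Fin m → L, (∀ i, u i ∈ K) → f u ∈ W)
    (h₂ : ∀ (i : Fin m) (u : Fin m → L), u i = x → (∀ j, j ≠ i → u j ∈ K) → f u ∈ W)
    (u : Fin m → L) (hu : ∀ i, u i ∈ K ⊔ F ∙ x) : f u ∈ W := by
  induction m with
  | zero => exact h₁ u fun i => i.elim0
  | succ m ih =>
    obtain ⟨k, hk, y, hy, h0⟩ := Submodule.mem_sup.1 (hu 0)
    obtain ⟨t, rfl⟩ := Submodule.mem_span_singleton.1 hy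
    have e : f u = f.curryLeft k (Fin.tail u) + t • f.curryLeft x (Fin.tail u) := by
      have : f u = f.curryLeft (u 0) (Fin.tail u) := by
        rw [AlternatingMap.curryLeft_apply_apply]
        congr 1
        exact (Fin.cons_self_tail u).symm
      rw [this, ← h0, map_add, map_smul]
      rfl
    rw [e]
    refine W.add_mem (ih _ ?_ ?_ _ fun i => hu i.succ)
      (W.smul_mem _ (ih _ ?_ ?_ _ fun i => hu i.succ))
    · intro v hv
      refine h₁ _ fun i => ?_
      cases i using Fin.cases with
      | zero => exact hk
      | succ i => exact hv i
    · intro i v hi hv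
      refine h₂ i.succ _ hi fun j hj => ?_
      cases j using Fin.cases with
      | zero => exact hk
      | succ j => exact hv j fun h => hj (h ▸ rfl)
    · intro v hv
      refine h₂ 0 _ rfl fun j hj => ?_
      cases j using Fin.cases with
      | zero => exact absurd rfl hj
      | succ j => exact hv j
    · intro i v hi _
      have : f.curryLeft x v = 0 :=
        f.map_eq_zero_of_eq (Matrix.vecCons x v) (i := 0) (j := i.succ) (by simp [hi])
          (Fin.succ_ne_zero i).symm
      rw [this]
      exact W.zero_mem

theorem IsJacobi.ad_ad {f : AlternatingMap F L L (Fin (m + 1))} (hf : IsJacobi f)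
    (y a : Fin m → L) (v : L) :
    ad f y (ad f a v) =
      (∑ i, ad f (Function.update a i (ad f y (a i))) v) + ad f a (ad f y v) := by
  rw [ad_apply f a v, hf, Fin.sum_univ_castSucc]
  congr 1
  · refine Finset.sum_congr rfl fun i _ => ?_
    rw [Fin.snoc_castSucc, ad_apply f (Function.update _ _ _), Fin.snoc_update]
  · rw [Fin.update_snoc_last, Fin.snoc_last, ad_apply f a]

theorem IsJacobi.curryLeft {f : AlternatingMap F L L (Fin (m + 2))} (hf : IsJacobi f) (x : L) :
    IsJacobi (f.curryLeft x) := by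
  intro y z
  rw [ad_curryLeft]
  change ad f (Fin.cons x y) (f (Fin.cons x z)) = _
  rw [hf, Fin.sum_univ_succ]
  have h0 : ad f (Fin.cons x y) x = 0 :=
    f.map_eq_zero_of_eq _ (i := 0) (j := Fin.last _)
      (by rw [← Fin.cons_snoc_eq_snoc_cons, ← Fin.succ_last]; simp) (Fin.last_pos).ne
  have h1 : f (Function.update (Fin.cons x z : Fin (m + 2) → L) 0
      (ad f (Fin.cons x y) ((Fin.cons x z : Fin (m + 2) → L) 0))) = 0 := by
    rw [Fin.cons_zero, h0]
    exact f.map_coord_zero 0 (Function.update_self _ _ _)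
  rw [h1, zero_add]
  refine Finset.sum_congr rfl fun i _ => ?_
  rw [← Fin.cons_update, Fin.cons_succ]
  rfl

theorem isTriangularOn_singleton (T : L →ₗ[F] L) (V : Submodule F L) (hV : V ≤ engel T) :
    IsTriangularOn {T} V := by
  classical
  intro W V' hlt hle _ hT'
  obtain ⟨v, hv, hvW⟩ := SetLike.exists_of_lt hlt
  have hex : ∃ r, (T ^ r) v ∈ W := by
    obtain ⟨r, hr⟩ := hV (hle hv)
    exact ⟨r, hr ▸ W.zero_mem⟩
  have hpow : ∀ r, (T ^ r) v ∈ V' := by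
    intro r
    induction r with
    | zero => exact hv
    | succ r ih => rw [pow_succ']; exact hT' T rfl _ ih
  obtain ⟨r, hr⟩ : ∃ r, Nat.find hex = r + 1 := by
    refine Nat.exists_eq_succ_of_ne_zero fun h => hvW ?_
    simpa [h] using Nat.find_spec hex
  refine ⟨(T ^ r) v, hpow r, Nat.find_min hex (by omega), ?_⟩
  rintro s rfl
  have := Nat.find_spec hex
  rw [hr, pow_succ'] at this
  exact this

/-- The theorem of Engel for brackets satisfying the generalized Jacobi identity. -/
theorem isTriangularOn_adSet [FiniteDimensional F L] (f : AlternatingMap F L L (Fin (m + 1)))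
    (hf : IsJacobi f) (U V : Submodule F L) (hUV : U ≤ V)
    (hU : ∀ a : Fin (m + 1) → L, (∀ i, a i ∈ U) → f a ∈ U)
    (hnil : ∀ a : Fin m → L, (∀ i, a i ∈ U) → V ≤ engel (ad f a)) :
    IsTriangularOn (adSet f U) V := by
  induction m generalizing U V with
  | zero =>
    have : adSet f U = {ad f ![]} := by
      ext d
      simp [adSet, Subsingleton.elim _ (![] : Fin 0 → L)]
    rw [this]
    exact isTriangularOn_singleton _ _ (hnil _ fun i => i.elim0)
  | succ m ih =>
    let P : Submodule F L → Prop := fun K =>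
      K ≤ U ∧ (∀ a : Fin (m + 2) → L, (∀ i, a i ∈ K) → f a ∈ K) ∧ IsTriangularOn (adSet f K) V
    have hbot : P ⊥ := by
      refine ⟨bot_le, fun a ha => ?_, ?_⟩
      · rw [f.map_coord_zero 0 ((Submodule.mem_bot F).1 (ha 0))]
        exact Submodule.zero_mem _
      · intro W V' hlt _ _ _
        obtain ⟨v, hv, hvW⟩ := SetLike.exists_of_lt hlt
        refine ⟨v, hv, hvW, ?_⟩
        rintro _ ⟨a, ha, rfl⟩
        have : ad f a v = 0 := f.map_coord_zero (0 : Fin (m + 1)).castSucc (by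
          rw [Fin.snoc_castSucc]; exact (Submodule.mem_bot F).1 (ha 0))
        rw [this]
        exact W.zero_mem
    obtain ⟨K, ⟨hKU, hK, hKtri⟩, hmax⟩ :=
      WellFounded.has_min (wellFounded_gt : WellFounded fun a b : Submodule F L => a > b)
        {K | P K} ⟨⊥, hbot⟩
    rcases hKU.eq_or_lt with rfl | hlt
    · exact hKtri
    exfalso
    obtain ⟨x, hxU, hxK, hx⟩ := hKtri K U hlt hUV
      (by
        rintro _ ⟨a, ha, rfl⟩ v hv
        refine hK _ fun i => ?_
        cases i using Fin.lastCases <;> simp [hv, ha])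
      (by
        rintro _ ⟨a, ha, rfl⟩ v hv
        refine hU _ fun i => ?_
        cases i using Fin.lastCases <;> simp [hv, fun i => hKU (ha i)])
    set K' := K ⊔ F ∙ x with hK'
    have hxcons : ∀ v : Fin (m + 1) → L, (∀ i, v i ∈ K) → f (Fin.cons x v) ∈ K := fun v hv =>
      (ad_mem_iff_cons_mem f K v x).1 (hx _ ⟨v, hv, rfl⟩)
    have hK'K : ∀ u : Fin (m + 2) → L, (∀ i, u i ∈ K') → f u ∈ K := by
      refine map_mem_of_mem_sup_span_singleton K K x f hK fun i u hi hu => ?_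
      rw [← map_comp_swap_mem_iff f K u 0 i, ← Fin.cons_self_tail (u ∘ Equiv.swap 0 i)]
      have : (u ∘ Equiv.swap 0 i) 0 = x := by simp [hi]
      rw [this]
      refine hxcons _ fun j => hu _ fun h => ?_
      have := (Equiv.swap 0 i).injective (h.trans (Equiv.swap_apply_left 0 i).symm)
      exact Fin.succ_ne_zero _ this
    have hK'U : K' ≤ U := sup_le hKU ((Submodule.span_singleton_le_iff_mem _ _).2 hxU)
    have hKK' : K ≤ K' := le_sup_left
    have hxK' : x ∈ K' := (le_sup_right : _ ≤ K') (Submodule.mem_span_singleton_self x)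
    refine hmax K' ⟨hK'U, fun a ha => hKK' (hK'K a ha), ?_⟩
      (lt_of_le_of_ne hKK' fun h => hxK (h ▸ hxK'))
    intro W V' hWV hV'V hWinv hVinv
    -- The vectors of `V'` sent into `W` by all operators from `K`.
    let E : Submodule F L :=
      { carrier := {v | v ∈ V' ∧ ∀ s ∈ adSet f K, s v ∈ W}
        zero_mem' := ⟨V'.zero_mem, fun s _ => by rw [map_zero]; exact W.zero_mem⟩
        add_mem' := fun ha hb => ⟨V'.add_mem ha.1 hb.1, fun s hs => by
          rw [map_add]; exact W.add_mem (ha.2 s hs) (hb.2 s hs)⟩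
        smul_mem' := fun c _ ha => ⟨V'.smul_mem c ha.1, fun s hs => by
          rw [map_smul]; exact W.smul_mem c (ha.2 s hs)⟩ }
    have hsub : adSet f K ⊆ adSet f K' := by
      rintro _ ⟨a, ha, rfl⟩
      exact ⟨a, fun i => hKK' (ha i), rfl⟩
    have hEinv : ∀ s ∈ adSet f K', ∀ v ∈ E, s v ∈ E := by
      rintro _ ⟨y, hy, rfl⟩ v ⟨hv, hvW⟩
      refine ⟨hVinv _ ⟨y, hy, rfl⟩ v hv, ?_⟩
      rintro _ ⟨a, ha, rfl⟩
      have h := hf.ad_ad y a v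
      rw [← sub_eq_iff_eq_add'] at h
      rw [← h]
      refine W.sub_mem (hWinv _ ⟨y, hy, rfl⟩ _ (hvW _ ⟨a, ha, rfl⟩))
        (W.sum_mem fun i _ => hvW _ ⟨_, fun j => ?_, rfl⟩)
      rcases eq_or_ne j i with rfl | hj
      · rw [Function.update_self]
        refine hK'K _ fun l => ?_
        cases l using Fin.lastCases <;> simp [hy, hKK' (ha j)]
      · rw [Function.update_of_ne hj]
        exact ha j
    have hWE : W < E := by
      have hle : W ≤ E := fun v hv => ⟨hWV.le hv, fun s hs => hWinv s (hsub hs) v hv⟩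
      obtain ⟨v, hv, hvW, hvs⟩ := hKtri W V' hWV hV'V
        (fun s hs => hWinv s (hsub hs)) (fun s hs => hVinv s (hsub hs))
      exact lt_of_le_of_ne hle fun h => hvW (h ▸ (⟨hv, hvs⟩ : v ∈ E))
    have hcons : ∀ a : Fin m → L, (∀ i, a i ∈ K) →
        ∀ i, (Fin.cons x a : Fin (m + 1) → L) i ∈ K' := by
      intro a ha i
      cases i using Fin.cases with
      | zero => exact hxK'
      | succ i => exact hKK' (ha i)
    have hg := ih (f.curryLeft x) (hf.curryLeft x) K V (hKU.trans hUV)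
      (fun a ha => hxcons a ha)
      (fun a ha => by
        rw [ad_curryLeft]
        exact hnil _ fun i => hK'U (hcons a ha i))
    have hgsub : adSet (f.curryLeft x) K ⊆ adSet f K' := by
      rintro _ ⟨a, ha, rfl⟩
      exact ⟨_, hcons a ha, ad_curryLeft f x a⟩
    obtain ⟨v, hvE, hvW, hvs⟩ := hg W E hWE (fun v hv => hV'V hv.1)
      (fun s hs => hWinv s (hgsub hs)) (fun s hs => hEinv s (hgsub hs))
    refine ⟨v, hvE.1, hvW, ?_⟩
    rintro _ ⟨u, hu, rfl⟩
    rw [ad_mem_iff_cons_mem]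
    refine map_mem_of_mem_sup_span_singleton K W x (f.curryLeft v) ?_ ?_ u hu
    · intro a ha
      exact (ad_mem_iff_cons_mem f W a v).1 (hvE.2 _ ⟨a, ha, rfl⟩)
    · intro i a hi ha
      rw [← map_comp_swap_mem_iff (f.curryLeft v) W a 0 i]
      refine (ad_mem_iff_cons_mem f W _ v).1 (hvs _ ⟨Fin.tail (a ∘ Equiv.swap 0 i), ?_, ?_⟩)
      · refine fun j => ha _ fun h => ?_
        have := (Equiv.swap 0 i).injective (h.trans (Equiv.swap_apply_left 0 i).symm)
        exact Fin.succ_ne_zero _ this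
      · rw [ad_curryLeft]
        congr 1
        rw [← Fin.cons_self_tail (a ∘ Equiv.swap 0 i)]
        simp [hi]

end Engel

section Charpoly

open Polynomial

variable {V V' : Type*} [AddCommGroup V] [Module F V] [FiniteDimensional F V]
  [AddCommGroup V'] [Module F V'] [FiniteDimensional F V']

theorem exists_polynomial_eval_eq_charpoly_coeff (A B : Module.End F V) (j : ℕ) :
    ∃ q : F[X], q.natDegree ≤ Module.finrank F V ∧
      ∀ t : F, q.eval t = (A + t • B).charpoly.coeff j := by
  let b := Module.Free.chooseBasis F (Module.End F V)
  let φ : Module.End F V →ₗ[F] Module.End F V := LinearMap.id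
  let ψ := MvPolynomial.aeval (R := F) fun i => C (b.repr B i) * X + C (b.repr A i)
  rcases le_or_gt j (Module.finrank F V) with hj | hj
  · obtain ⟨k, hk⟩ := Nat.exists_eq_add_of_le hj
    refine ⟨ψ ((LinearMap.polyCharpoly φ b).coeff j), ?_, fun t => ?_⟩
    · refine le_trans ?_ (show k * 1 ≤ _ by omega)
      exact MvPolynomial.aeval_natDegree_le _
        (LinearMap.polyCharpoly_coeff_isHomogeneous φ b _ _ hk.symm).totalDegree_le _
        fun i => natDegree_linear_le
    · have aux : (fun i => b.repr B i * t + b.repr A i) = b.repr (A + t • B) := by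
        ext i
        simp [mul_comm t, add_comm]
      have h := LinearMap.polyCharpoly_map_eq_charpoly φ b (A + t • B)
      rw [← aux] at h
      change _ = LinearMap.charpoly (A + t • B) at h
      rw [← h, coeff_map, ← coe_aeval_eq_eval]
      have := MvPolynomial.comp_aeval_apply (R := F) (aeval t)
        (f := fun i => C (b.repr B i) * X + C (b.repr A i)) ((LinearMap.polyCharpoly φ b).coeff j)
      simp only [map_add, map_mul, aeval_C, aeval_X, Algebra.algebraMap_self, RingHom.id_apply]
        at this
      exact this
  · refine ⟨0, by simp, fun t => ?_⟩
    rw [coeff_eq_zero_of_natDegree_lt (by rwa [LinearMap.charpoly_natDegree]), eval_zero]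

theorem exists_charpoly_coeff_ne_zero_on_lines
    (hF : ((Module.finrank F V + Module.finrank F V' : ℕ) : Cardinal) < Cardinal.mk F)
    (A B : Module.End F V) (A' B' : Module.End F V') (s s' : F) (j j' : ℕ)
    (h : (A + s • B).charpoly.coeff j ≠ 0) (h' : (A' + s' • B').charpoly.coeff j' ≠ 0) :
    ∃ t : F, (A + t • B).charpoly.coeff j ≠ 0 ∧ (A' + t • B').charpoly.coeff j' ≠ 0 := by
  obtain ⟨q, hq, hqe⟩ := exists_polynomial_eval_eq_charpoly_coeff A B j
  obtain ⟨q', hq', hqe'⟩ := exists_polynomial_eval_eq_charpoly_coeff A' B' j'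
  have hne : q ≠ 0 := by
    rintro rfl
    exact h (by rw [← hqe, eval_zero])
  have hne' : q' ≠ 0 := by
    rintro rfl
    exact h' (by rw [← hqe', eval_zero])
  obtain ⟨t, ht⟩ := exists_eval_ne_zero_of_natDegree_lt_card (q * q') (mul_ne_zero hne hne')
    (lt_of_le_of_lt (by exact_mod_cast natDegree_mul_le.trans (add_le_add hq hq')) hF)
  rw [eval_mul, hqe, hqe'] at ht
  exact ⟨t, left_ne_zero_of_mul ht, right_ne_zero_of_mul ht⟩

theorem exists_charpoly_coeff_ne_zero_of_affine {U : Type*} [AddCommGroup U] [Module F U]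
    {m : ℕ} (hF : ((Module.finrank F V + Module.finrank F V' : ℕ) : Cardinal) < Cardinal.mk F)
    (ρ : (Fin m → U) → Module.End F V) (ρ' : (Fin m → U) → Module.End F V')
    (hρ : ∀ u i x w (t : F), ρ (Function.update u i (x + t • w)) =
      ρ (Function.update u i x) + t • ρ (Function.update u i w))
    (hρ' : ∀ u i x w (t : F), ρ' (Function.update u i (x + t • w)) =
      ρ' (Function.update u i x) + t • ρ' (Function.update u i w))
    (j j' : ℕ) (a b : Fin m → U) (ha : (ρ a).charpoly.coeff j ≠ 0)
    (hb : (ρ' b).charpoly.coeff j' ≠ 0) :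
    ∃ u, (ρ u).charpoly.coeff j ≠ 0 ∧ (ρ' u).charpoly.coeff j' ≠ 0 := by
  suffices h : ∀ s : Finset (Fin m), ∃ a' b' : Fin m → U, (∀ i ∈ s, a' i = b' i) ∧
      (ρ a').charpoly.coeff j ≠ 0 ∧ (ρ' b').charpoly.coeff j' ≠ 0 by
    obtain ⟨a', b', h, h₁, h₂⟩ := h Finset.univ
    obtain rfl : a' = b' := funext fun i => h i (Finset.mem_univ i)
    exact ⟨a', h₁, h₂⟩
  intro s
  induction s using Finset.induction_on with
  | empty => exact ⟨a, b, by simp, ha, hb⟩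
  | insert i s _ ih =>
    obtain ⟨a', b', h, h₁, h₂⟩ := ih
    obtain ⟨t, ht₁, ht₂⟩ := exists_charpoly_coeff_ne_zero_on_lines hF
      (ρ (Function.update a' i (a' i))) (ρ (Function.update a' i (b' i - a' i)))
      (ρ' (Function.update b' i (a' i))) (ρ' (Function.update b' i (b' i - a' i))) 0 1 j j'
      (by rwa [← hρ, zero_smul, add_zero, Function.update_eq_self])
      (by rwa [← hρ', one_smul, add_sub_cancel, Function.update_eq_self])
    rw [← hρ] at ht₁
    rw [← hρ'] at ht₂
    refine ⟨_, _, fun k hk => ?_, ht₁, ht₂⟩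
    rcases eq_or_ne k i with rfl | hki
    · simp
    · simpa [hki] using h k (Finset.mem_of_mem_insert_of_ne hk hki)

theorem charpoly_coeff_zero_ne_zero_iff_injective (A : Module.End F V) :
    A.charpoly.coeff 0 ≠ 0 ↔ Function.Injective A := by
  rw [← LinearMap.ker_eq_bot, ← LinearMap.isUnit_iff_ker_eq_bot, LinearMap.isUnit_iff_isUnit_det,
    LinearMap.det_eq_sign_charpoly_coeff, isUnit_iff_ne_zero]
  simp

theorem exists_charpoly_coeff_ne_zero_iff_not_nilpotent (A : Module.End F V) :
    (∃ j < Module.finrank F V, A.charpoly.coeff j ≠ 0) ↔ ¬ ∀ v, ∃ r, (A ^ r) v = 0 := by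
  rw [← LinearMap.charpoly_eq_X_pow_iff]
  constructor
  · rintro ⟨j, hj, hne⟩ h
    rw [h, coeff_X_pow, if_neg hj.ne] at hne
    exact hne rfl
  · intro h
    by_contra! hcon
    refine h ?_
    rw [← LinearMap.charpoly_natDegree A,
      A.charpoly_monic.eq_X_pow_iff_natDegree_le_natTrailingDegree]
    refine le_natTrailingDegree A.charpoly_monic.ne_zero fun j hj => hcon j ?_
    rwa [LinearMap.charpoly_natDegree] at hj

end Charpoly

section EngelSubalgebra

variable {m : ℕ}

theorem mem_engel_of_apply_mem {d : L →ₗ[F] L} {x : L} (h : d x ∈ engel d) : x ∈ engel d := by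
  obtain ⟨r, hr⟩ := h
  exact ⟨r + 1, by rw [pow_succ]; exact hr⟩

theorem IsJacobi.map_mem_engel {f : AlternatingMap F L L (Fin (m + 1))} (hf : IsJacobi f)
    (a : Fin m → L) (x : Fin (m + 1) → L) (hx : ∀ i, x i ∈ engel (ad f a)) :
    f x ∈ engel (ad f a) := by
  choose r hr using hx
  induction hN : ∑ i, r i generalizing x r with
  | zero =>
    have h0 : r 0 = 0 := (Finset.sum_eq_zero_iff.1 hN) 0 (Finset.mem_univ 0)
    have := hr 0
    rw [h0] at this
    rw [f.map_coord_zero 0 this]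
    exact Submodule.zero_mem _
  | succ N ih =>
    by_cases h : ∃ i, r i = 0
    · obtain ⟨i, hi⟩ := h
      have := hr i
      rw [hi] at this
      rw [f.map_coord_zero i this]
      exact Submodule.zero_mem _
    push Not at h
    refine mem_engel_of_apply_mem ?_
    rw [hf]
    refine Submodule.sum_mem _ fun i _ => ih _ (Function.update r i (r i - 1)) (fun j => ?_) ?_
    · rcases eq_or_ne j i with rfl | hj
      · obtain ⟨k, hk⟩ := Nat.exists_eq_succ_of_ne_zero (h j)
        have := hr j
        rw [hk, pow_succ] at this
        simpa [hk] using this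
      · simpa [hj] using hr j
    · have h₁ := Finset.sum_update_of_mem (Finset.mem_univ i) r (r i - 1)
      have h₂ := Finset.add_sum_erase Finset.univ r (Finset.mem_univ i)
      rw [Finset.sdiff_singleton_eq_erase] at h₁
      have := h i
      omega

theorem self_mem_engel_ad (f : AlternatingMap F L L (Fin (m + 1))) (a : Fin m → L) (i : Fin m) :
    a i ∈ engel (ad f a) := by
  refine ⟨1, ?_⟩
  rw [pow_one]
  exact f.map_eq_zero_of_eq _ (i := i.castSucc) (j := Fin.last m) (by simp)
    (Fin.castSucc_lt_last i).ne

/-- If an Engel subalgebra `E` is of minimal dimension among those defined by arguments in `E`,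
then all the inner operators with arguments in `E` are nilpotent on `E`. -/
theorem le_engel_ad_of_finrank_minimal [FiniteDimensional F L]
    (hF : (Module.finrank F L : Cardinal) < Cardinal.mk F)
    (f : AlternatingMap F L L (Fin (m + 1))) (E : Submodule F L)
    (hE : ∀ x : Fin (m + 1) → L, (∀ i, x i ∈ E) → f x ∈ E)
    (a : Fin m → L) (ha : ∀ i, a i ∈ E) (haE : engel (ad f a) = E)
    (hmin : ∀ u : Fin m → L, Module.finrank F E ≤ Module.finrank F (engel (ad f u)))
    (b : Fin m → L) (hb : ∀ i, b i ∈ E) : E ≤ engel (ad f b) := by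
  let g := (f.toMultilinearMap.curryRight).compLinearMap fun _ : Fin m => E.subtype
  have hg : ∀ u, ∀ x ∈ E, g u x ∈ E := by
    intro u x hx
    refine hE (Fin.snoc (fun i => (u i : L)) x) fun i => ?_
    cases i using Fin.lastCases <;> simp [hx]
  have hline : ∀ u i x w (t : F), g (Function.update u i (x + t • w)) =
      g (Function.update u i x) + t • g (Function.update u i w) := by
    intro u i x w t
    rw [g.map_update_add, g.map_update_smul]
  let ρ : (Fin m → E) → Module.End F E := fun u => (g u).restrict (hg u)
  let σ : (Fin m → E) → Module.End F (L ⧸ E) := fun u => E.mapQ E (g u) (hg u)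
  have hρpow : ∀ u r x, (((ρ u) ^ r) x : L) = ((g u) ^ r) x := by
    intro u r
    induction r with
    | zero => intro x; rfl
    | succ r ih => intro x; rw [pow_succ, pow_succ]; exact ih _
  have hρnil : ∀ u, (∀ x, ∃ r, ((ρ u) ^ r) x = 0) ↔ E ≤ engel (g u) := by
    intro u
    constructor
    · intro h x hx
      obtain ⟨r, hr⟩ := h ⟨x, hx⟩
      exact ⟨r, by rw [← hρpow u r ⟨x, hx⟩, hr]; rfl⟩
    · intro h x
      obtain ⟨r, hr⟩ := h x.2
      exact ⟨r, Subtype.ext (by rw [hρpow, hr]; rfl)⟩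
  have hσinj : ∀ u, Function.Injective (σ u) ↔ ∀ x, g u x ∈ E → x ∈ E := by
    intro u
    rw [injective_iff_map_eq_zero]
    constructor
    · intro h x hx
      rw [← Submodule.Quotient.mk_eq_zero]
      exact h _ ((Submodule.Quotient.mk_eq_zero E).2 hx)
    · intro h x
      obtain ⟨x, rfl⟩ := Submodule.Quotient.mk_surjective E x
      intro hx
      exact (Submodule.Quotient.mk_eq_zero E).2 (h x ((Submodule.Quotient.mk_eq_zero E).1 hx))
  by_contra hcon
  let a' : Fin m → E := fun i => ⟨a i, ha i⟩
  let b' : Fin m → E := fun i => ⟨b i, hb i⟩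
  obtain ⟨j, hj, hbj⟩ := (exists_charpoly_coeff_ne_zero_iff_not_nilpotent (ρ b')).2
    fun h => hcon ((hρnil b').1 h)
  obtain ⟨u, hu₁, hu₂⟩ := exists_charpoly_coeff_ne_zero_of_affine
    (by rwa [Submodule.finrank_quotient_add_finrank]) σ ρ
    (fun u i x w t => by
      ext z
      simp only [σ, hline]
      rfl)
    (fun u i x w t => by
      ext z
      simp only [ρ, hline]
      rfl) 0 j a' b'
    ((charpoly_coeff_zero_ne_zero_iff_injective _).2 ((hσinj a').2 fun x hx => by
      have hx' : ad f a x ∈ engel (ad f a) := haE.symm ▸ hx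
      exact haE ▸ mem_engel_of_apply_mem hx')) hbj
  rw [charpoly_coeff_zero_ne_zero_iff_injective, hσinj] at hu₁
  have hle : engel (g u) ≤ E := by
    rintro x ⟨r, hr⟩
    induction r generalizing x with
    | zero => exact (show x = 0 from hr) ▸ E.zero_mem
    | succ r ih => exact hu₁ x (ih (by rw [pow_succ] at hr; exact hr))
  have heq := Submodule.eq_of_le_of_finrank_le hle (hmin fun i => (u i : L))
  exact (exists_charpoly_coeff_ne_zero_iff_not_nilpotent (ρ u)).1 ⟨j, hj, hu₂⟩
    ((hρnil u).2 heq.ge)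

end EngelSubalgebra

theorem exists_lcsIn_le_of_isTriangularOn [FiniteDimensional F L]
    (f : AlternatingMap F L L (Fin (n + 2))) (E : Submodule F L) (hE : IsSubalg f E)
    (htri : IsTriangularOn (adSet f E) E) (W : Submodule F L) (hWE : W ≤ E)
    (hW : ∀ s ∈ adSet f E, ∀ w ∈ W, s w ∈ W) : ∃ r, lcsIn f E r ≤ W := by
  induction W using WellFoundedGT.induction with
  | ind W ih =>
    rcases hWE.eq_or_lt with rfl | hlt
    · exact ⟨0, le_rfl⟩
    obtain ⟨v, hvE, hvW, hv⟩ := htri W E hlt le_rfl hW (by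
      rintro _ ⟨a, ha, rfl⟩ x hx
      refine hE _ fun i => ?_
      cases i using Fin.lastCases <;> simp [hx, ha])
    have hmap : ∀ s ∈ adSet f E, ∀ w ∈ W ⊔ F ∙ v, s w ∈ W := by
      intro s hs w hw
      obtain ⟨x, hx, y, hy, rfl⟩ := Submodule.mem_sup.1 hw
      obtain ⟨t, rfl⟩ := Submodule.mem_span_singleton.1 hy
      rw [map_add, map_smul]
      exact W.add_mem (hW s hs x hx) (W.smul_mem t (hv s hs))
    have hvW' : v ∈ W ⊔ F ∙ v :=
      (le_sup_right : _ ≤ W ⊔ F ∙ v) (Submodule.mem_span_singleton_self v)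
    obtain ⟨r, hr⟩ := ih (W ⊔ F ∙ v) (lt_of_le_of_ne le_sup_left fun h => hvW (h ▸ hvW'))
      (sup_le hWE ((Submodule.span_singleton_le_iff_mem _ _).2 hvE))
      fun s hs w hw => (le_sup_left : W ≤ _) (hmap s hs w hw)
    refine ⟨r + 1, Submodule.span_le.2 ?_⟩
    rintro _ ⟨a, ha, rfl⟩
    have := (ad_mem_iff_cons_mem f W (Fin.tail a) (a 0)).1
      (hmap _ ⟨Fin.tail a, fun i => ha i.succ, rfl⟩ _ (hr (ha 0)))
    rwa [Fin.cons_self_tail] at this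

/-- An `n`-Lie algebra of dimension `k` over a field with at least
`k + 1` elements has a Cartan subalgebra. -/
theorem stmt16 {F : Type*} [Field F] {L : Type*} [AddCommGroup L] [Module F L]
    [FiniteDimensional F L] {n : ℕ}
    (hF : (Module.finrank F L : Cardinal) + 1 ≤ Cardinal.mk F)
    (f : AlternatingMap F L L (Fin (n + 2)))
    (hf : IsNLie f) :
    ∃ S : Submodule F L, IsCartan f S := by
  have hF' : (Module.finrank F L : Cardinal) < Cardinal.mk F :=
    lt_of_lt_of_le (by exact_mod_cast Nat.lt_succ_self _) hF
  have hJ : IsJacobi f := hf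
  obtain ⟨a, hmin⟩ : ∃ a : Fin (n + 1) → L, ∀ u : Fin (n + 1) → L,
      Module.finrank F (engel (ad f a)) ≤ Module.finrank F (engel (ad f u)) :=
    ⟨_, fun u => Function.argmin_le (fun a => Module.finrank F (engel (ad f a))) u⟩
  have hsub : IsSubalg f (engel (ad f a)) := hJ.map_mem_engel a
  have hnil := le_engel_ad_of_finrank_minimal hF' f _ hsub a (self_mem_engel_ad f a) rfl hmin
  refine ⟨engel (ad f a), hsub, ?_, Set.Subset.antisymm (fun x hx => ?_) fun x hx u hu => ?_⟩
  · obtain ⟨r, hr⟩ := exists_lcsIn_le_of_isTriangularOn f _ hsub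
      (isTriangularOn_adSet f hJ _ _ le_rfl hsub hnil) ⊥ bot_le (by
        rintro s - w hw
        rw [(Submodule.mem_bot F).1 hw, map_zero]
        exact Submodule.zero_mem _)
    exact ⟨r, le_bot_iff.1 hr⟩
  · exact mem_engel_of_apply_mem
      ((ad_mem_iff_cons_mem f _ a x).2 (hx a (self_mem_engel_ad f a)))
  · refine hsub _ fun i => ?_
    cases i using Fin.cases with
    | zero => exact hx
    | succ i => exact hu i

end NLie
end

section
/- Let L be a finite-dimensional n-Lie algebra and let d be a derivation of L such that d∘d = 0 and [d(L),d(L),(n-2)L] = 0. Then the linear map 1 + d is an automorphism of L, i.e. a bijective linear map α with [α(x1),…,α(xn)] = α([x1,…,xn]) for all x1,…,xn ∈ L. -/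
namespace NLie

open Finset

variable {F : Type*} [Field F] {L : Type*} [AddCommGroup L] [Module F L] {n : ℕ}

/-- If `f` vanishes whenever its first two arguments lie in `p`, then it vanishes whenever
any two of its arguments lie in `p`. -/
theorem map_eq_zero_of_two_mem (f : AlternatingMap F L L (Fin (n + 2))) (p : Submodule F L)
    (h : ∀ z : Fin (n + 2) → L, z 0 ∈ p → z 1 ∈ p → f z = 0)
    {z : Fin (n + 2) → L} {i j : Fin (n + 2)} (hij : i ≠ j) (hi : z i ∈ p) (hj : z j ∈ p) :
    f z = 0 := by
  set k := Equiv.swap 0 i j with hk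
  have hk0 : (0 : Fin (n + 2)) ≠ k := by
    intro h0
    apply hij
    have := congrArg (Equiv.swap 0 i) h0
    rwa [Equiv.swap_apply_left, hk, Equiv.swap_apply_self] at this
  let σ : Equiv.Perm (Fin (n + 2)) := Equiv.swap 0 i * Equiv.swap 1 k
  have h0 : σ 0 = i := by
    simp [σ, Equiv.swap_apply_of_ne_of_ne (Fin.zero_ne_one) hk0]
  have h1 : σ 1 = j := by
    simp [σ, hk]
  have hσ : f (z ∘ σ) = 0 := h _ (by simpa [h0] using hi) (by simpa [h1] using hj)
  rw [f.map_perm] at hσ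
  rcases Int.units_eq_one_or (Equiv.Perm.sign σ) with hs | hs <;> simpa [hs] using hσ

/-- If `f` vanishes whenever two of its arguments lie in `p`, then `f` is affine along
perturbations of its arguments by elements of `p`. -/
theorem map_add_eq_of_two_mem (f : AlternatingMap F L L (Fin (n + 2))) (p : Submodule F L)
    (h : ∀ z : Fin (n + 2) → L, z 0 ∈ p → z 1 ∈ p → f z = 0)
    (x y : Fin (n + 2) → L) (hy : ∀ i, y i ∈ p) :
    f (x + y) = f x + ∑ i, f (Function.update x i (y i)) := by
  have hsub : ∑ s ∈ insert ∅ (univ.image fun i : Fin (n + 2) => ({i} : Finset (Fin (n + 2)))),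
      f (piecewise s y x) = ∑ s : Finset (Fin (n + 2)), f (s.piecewise y x) := by
    refine sum_subset (subset_univ _) fun s _ hs => ?_
    simp only [mem_insert, mem_image, mem_univ, true_and, not_or, not_exists] at hs
    obtain ⟨i, hi⟩ := nonempty_iff_ne_empty.mpr hs.1
    have hne : ∃ j ∈ s, j ≠ i := by
      by_contra! hall
      exact hs.2 i (eq_singleton_iff_unique_mem.mpr ⟨hi, hall⟩).symm
    obtain ⟨j, hj, hji⟩ := hne
    exact map_eq_zero_of_two_mem f p h hji (by simpa [hj] using hy j) (by simpa [hi] using hy i)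
  have hexp : f (y + x) = ∑ s : Finset (Fin (n + 2)), f (s.piecewise y x) :=
    f.toMultilinearMap.map_add_univ y x
  rw [add_comm x y, hexp, ← hsub, sum_insert (by simp),
    sum_image fun a _ b _ hab => singleton_injective hab]
  simp [piecewise_singleton]

/-- If `d` is a derivation of `L` with `d ∘ d = 0` and
`[d(L),d(L),(n-2)L] = 0`, then `1 + d` is an automorphism of `L`. -/
theorem stmt18 {F : Type*} [Field F] {L : Type*} [AddCommGroup L] [Module F L]
    [FiniteDimensional F L] {n : ℕ} (f : AlternatingMap F L L (Fin (n + 2)))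
    (hf : IsNLie f) (d : L →ₗ[F] L) (hd : IsDerivation f d)
    (hd2 : d ∘ₗ d = 0)
    (hdL : ∀ z : Fin (n + 2) → L,
      z 0 ∈ LinearMap.range d → z 1 ∈ LinearMap.range d → f z = 0) :
    Function.Bijective (LinearMap.id + d : L →ₗ[F] L) ∧
    ∀ x : Fin (n + 2) → L,
      f (fun i => (LinearMap.id + d : L →ₗ[F] L) (x i)) =
        (LinearMap.id + d : L →ₗ[F] L) (f x) := by
  have hdd : ∀ v, d (d v) = 0 := fun v => LinearMap.congr_fun hd2 v
  refine ⟨Function.bijective_iff_has_inverse.mpr ⟨fun v => v - d v, fun v => ?_, fun v => ?_⟩,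
    fun x => ?_⟩
  · simp [hdd]
  · simp [hdd]
  · simpa [hd x, Pi.add_def] using
      map_add_eq_of_two_mem f (LinearMap.range d) hdL x (fun i => d (x i)) fun i => ⟨x i, rfl⟩

end NLie
end
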